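/- arXiv:1403.6487 — 6 statements merged into one kernel-verified Lean document; each statement's English description precedes it below -/
import Mathlib

section
/- Let X be a topological space, let I and each J i be finite index types, and let C ⊆ X. Suppose (A i)_{i ∈ I} is a family of pairwise disjoint open subsets of X with C ⊆ ⋃_{i} closure (A i), and for each i ∈ I, (B i j)_{j ∈ J i} is a family of pairwise disjoint open subsets of X with B i j ⊆ A i for all j and A i ⊆ ⋃_{j} closure (B i j). Then the combined family (B i j) over all pairs (i, j) is pairwise disjoint, each member is open, and C ⊆ ⋃_{i, j} closure (B i j). -/
/-- Refinement/composition property of weak decompositions: if a family of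
pairwise disjoint open sets `A i` has closures covering `C`, and each `A i`
is covered by the closures of a pairwise disjoint family of open subsets
`B i j ⊆ A i`, then the combined family `B i j` is pairwise disjoint, open,
and its closures cover `C`. -/
theorem weak_decomposition_refine {X : Type*} [TopologicalSpace X]
    {I : Type*} [Finite I] {J : I → Type*} [∀ i, Finite (J i)]
    (C : Set X) (A : I → Set X) (B : ∀ i, J i → Set X)
    (hAopen : ∀ i, IsOpen (A i))
    (hAdisj : Pairwise (Function.onFun Disjoint A))
    (hCcov : C ⊆ ⋃ i, closure (A i))
    (hBopen : ∀ i j, IsOpen (B i j))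
    (hBdisj : ∀ i, Pairwise (Function.onFun Disjoint (B i)))
    (hBsub : ∀ i j, B i j ⊆ A i)
    (hAcov : ∀ i, A i ⊆ ⋃ j, closure (B i j)) :
    Pairwise (Function.onFun Disjoint (fun p : Σ i, J i => B p.1 p.2)) ∧
      (∀ p : Σ i, J i, IsOpen (B p.1 p.2)) ∧
      C ⊆ ⋃ i, ⋃ j, closure (B i j) := by
  refine ⟨?_, fun p => hBopen p.1 p.2, fun x hx => ?_⟩
  · rintro ⟨i, j⟩ ⟨i', j'⟩ hne
    by_cases h : i = i'
    · subst h
      exact hBdisj i fun hj => hne (congrArg (Sigma.mk i) hj)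
    · exact (hAdisj h).mono (hBsub i j) (hBsub i' j')
  · obtain ⟨i, hi⟩ := Set.mem_iUnion.1 (hCcov hx)
    exact Set.mem_iUnion.2 ⟨i, closure_minimal (hAcov i)
      (isClosed_iUnion_of_finite fun _ => isClosed_closure) hi⟩
end

section
/- Let X be a topological space, I a finite index type, and (A i)_{i ∈ I} a family of pairwise disjoint open subsets of X with X ⊆ ⋃_{i} closure (A i). Fix i₀ ∈ I, let J be a finite index type, and let (B j)_{j ∈ J} be a family of pairwise disjoint open subsets of X with B j ⊆ A i₀ for all j and A i₀ ⊆ ⋃_{j} closure (B j). Then the family consisting of all A i with i ≠ i₀ together with all B j is pairwise disjoint, each member is open, and X ⊆ union of the closures of its members. -/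
/-- Loop invariant of TI-Open-NuCAD: replacing one cell `A i₀` of a weak
decomposition of the whole space by a weak decomposition `B j` of that cell
again yields a weak decomposition of the whole space. -/
theorem weak_decomposition_replace_cell {X : Type*} [TopologicalSpace X]
    {I : Type*} [Finite I] {J : Type*} [Finite J]
    (A : I → Set X) (i₀ : I) (B : J → Set X)
    (hAopen : ∀ i, IsOpen (A i))
    (hAdisj : Pairwise (Function.onFun Disjoint A))
    (hcov : (Set.univ : Set X) ⊆ ⋃ i, closure (A i))
    (hBopen : ∀ j, IsOpen (B j))
    (hBdisj : Pairwise (Function.onFun Disjoint B))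
    (hBsub : ∀ j, B j ⊆ A i₀)
    (hAcov : A i₀ ⊆ ⋃ j, closure (B j)) :
    Pairwise (Function.onFun Disjoint
        (Sum.elim (fun i : {i : I // i ≠ i₀} => A i.1) B)) ∧
      (∀ k : {i : I // i ≠ i₀} ⊕ J,
        IsOpen (Sum.elim (fun i : {i : I // i ≠ i₀} => A i.1) B k)) ∧
      (Set.univ : Set X) ⊆
        ⋃ k, closure (Sum.elim (fun i : {i : I // i ≠ i₀} => A i.1) B k) := by
  refine ⟨?_, ?_, ?_⟩
  · rintro (⟨i, hi⟩ | j) (⟨i', hi'⟩ | j') hne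
    · exact hAdisj fun h => hne (by subst h; rfl)
    · exact (hAdisj hi).mono_right (hBsub j')
    · exact (hAdisj hi'.symm).mono_left (hBsub j)
    · exact hBdisj fun h => hne (by rw [h])
  · rintro (i | j)
    · exact hAopen i.1
    · exact hBopen j
  · intro x _
    obtain ⟨i, hx⟩ := Set.mem_iUnion.1 (hcov (Set.mem_univ x))
    by_cases hi : i = i₀
    · subst hi
      have hclosure : closure (A i) ⊆ ⋃ j, closure (B j) :=
        closure_minimal hAcov (isClosed_iUnion_of_finite fun _ => isClosed_closure)
      obtain ⟨j, hj⟩ := Set.mem_iUnion.1 (hclosure hx)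
      exact Set.mem_iUnion.2 ⟨Sum.inr j, hj⟩
    · exact Set.mem_iUnion.2 ⟨Sum.inl ⟨i, hi⟩, hx⟩
end

section
/- Let X be a topological space, B ⊆ X a preconnected set, and f, g : X → ℝ functions continuous on B with f x < g x for every x ∈ B. Then the band {(x, y) ∈ X × ℝ : x ∈ B ∧ f x < y < g x} is a preconnected subset of X × ℝ. -/
/-- The band over a preconnected set `B` between two functions continuous on
`B` with `f < g` on `B` is preconnected in `X × ℝ`. -/
theorem band_isPreconnected {X : Type*} [TopologicalSpace X]
    {B : Set X} (hB : IsPreconnected B) {f g : X → ℝ}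
    (hf : ContinuousOn f B) (hg : ContinuousOn g B)
    (hfg : ∀ x ∈ B, f x < g x) :
    IsPreconnected {p : X × ℝ | p.1 ∈ B ∧ f p.1 < p.2 ∧ p.2 < g p.1} := by
  -- The band is the image of `B × (0, 1)` under fibrewise affine interpolation.
  have hmaps : Set.MapsTo Prod.fst (B ×ˢ Set.Ioo (0 : ℝ) 1) B := fun _ hp => hp.1
  have hf' := hf.comp continuousOn_fst hmaps
  have hg' := hg.comp continuousOn_fst hmaps
  have hcont : ContinuousOn (fun p : X × ℝ => (p.1, f p.1 + p.2 * (g p.1 - f p.1)))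
      (B ×ˢ Set.Ioo (0 : ℝ) 1) :=
    continuousOn_fst.prodMk (hf'.add (continuousOn_snd.mul (hg'.sub hf')))
  convert (hB.prod (isPreconnected_Ioo (a := (0 : ℝ)) (b := 1))).image _ hcont using 1
  ext ⟨x, y⟩
  constructor
  · rintro ⟨hx, hfy, hyg⟩
    dsimp only at hx hfy hyg
    have hpos : 0 < g x - f x := sub_pos.2 (hfg x hx)
    refine ⟨(x, (y - f x) / (g x - f x)),
      ⟨hx, div_pos (sub_pos.2 hfy) hpos, (div_lt_one hpos).2 (by linarith)⟩, ?_⟩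
    simp [div_mul_cancel₀ _ hpos.ne']
  · rintro ⟨⟨x', t⟩, ⟨hx, ht0, ht1⟩, h⟩
    obtain ⟨rfl, rfl⟩ := Prod.mk.inj h
    dsimp only at hx ht0 ht1 ⊢
    have hpos : 0 < g x' - f x' := sub_pos.2 (hfg x' hx)
    refine ⟨hx, ?_, ?_⟩ <;> dsimp only <;> nlinarith
end

section
/- Let X be a topological space, let B' ⊆ B ⊆ X with B and B' open, let f, g : X → ℝ be continuous on B, and let f', g' : X → ℝ be continuous on B', with f x ≤ f' x < g' x ≤ g x for every x ∈ B'. Then the set ((B' × ℝ) ∩ {(x, y) : x ∈ B ∧ f x < y < g x}) \ closure {(x, y) : x ∈ B' ∧ f' x < y < g' x} equals the union of the two bands {(x, y) : x ∈ B' ∧ f x < y < f' x} and {(x, y) : x ∈ B' ∧ g' x < y < g x}. -/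
/-- Over a point of an open base on which the bounding functions are continuous, the closure of
a band with nonempty fibres is the corresponding closed band. -/
theorem mem_closure_band_iff {X : Type*} [TopologicalSpace X] {B : Set X} (hB : IsOpen B)
    {f g : X → ℝ} (hf : ContinuousOn f B) (hg : ContinuousOn g B)
    (hfg : ∀ x ∈ B, f x < g x) {p : X × ℝ} (hp : p.1 ∈ B) :
    p ∈ closure {p : X × ℝ | p.1 ∈ B ∧ f p.1 < p.2 ∧ p.2 < g p.1} ↔
      f p.1 ≤ p.2 ∧ p.2 ≤ g p.1 := by
  constructor
  · intro h
    have hf₀ : ContinuousAt (fun q : X × ℝ => f q.1) p :=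
      (hf.continuousAt (hB.mem_nhds hp)).comp continuousAt_fst
    have hg₀ : ContinuousAt (fun q : X × ℝ => g q.1) p :=
      (hg.continuousAt (hB.mem_nhds hp)).comp continuousAt_fst
    rw [mem_closure_iff_frequently] at h
    refine ⟨le_of_not_gt fun hlt => ?_, le_of_not_gt fun hlt => ?_⟩
    · obtain ⟨q, hq, hlt'⟩ :=
        (h.and_eventually (continuousAt_snd.eventually_lt hf₀ hlt)).exists
      exact lt_asymm hq.2.1 hlt'
    · obtain ⟨q, hq, hlt'⟩ :=
        (h.and_eventually (hg₀.eventually_lt continuousAt_snd hlt)).exists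
      exact lt_asymm hq.2.2 hlt'
  · intro h
    have hmem : p.2 ∈ closure (Set.Ioo (f p.1) (g p.1)) := by
      rw [closure_Ioo (hfg _ hp).ne]
      exact h
    exact map_mem_closure (Continuous.prodMk_right p.1) hmem fun y hy => ⟨hp, hy⟩


/-- Point 4 of the Open NuCAD definition: the cylinder over the inner base
`B'`, intersected with the outer band, with the closure of the inner band
removed, is the union of the lower and upper bands over `B'`. -/
theorem cylinder_inter_band_diff_closure {X : Type*} [TopologicalSpace X]
    {B B' : Set X} (hB : IsOpen B) (hB' : IsOpen B') (hBB : B' ⊆ B)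
    {f g f' g' : X → ℝ}
    (hf : ContinuousOn f B) (hg : ContinuousOn g B)
    (hf' : ContinuousOn f' B') (hg' : ContinuousOn g' B')
    (hff' : ∀ x ∈ B', f x ≤ f' x) (hf'g' : ∀ x ∈ B', f' x < g' x)
    (hg'g : ∀ x ∈ B', g' x ≤ g x) :
    ((B' ×ˢ (Set.univ : Set ℝ)) ∩
        {p : X × ℝ | p.1 ∈ B ∧ f p.1 < p.2 ∧ p.2 < g p.1}) \
      closure {p : X × ℝ | p.1 ∈ B' ∧ f' p.1 < p.2 ∧ p.2 < g' p.1} =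
    {p : X × ℝ | p.1 ∈ B' ∧ f p.1 < p.2 ∧ p.2 < f' p.1} ∪
      {p : X × ℝ | p.1 ∈ B' ∧ g' p.1 < p.2 ∧ p.2 < g p.1} := by
  ext p
  simp only [Set.mem_sdiff, Set.mem_inter_iff, Set.mem_prod, Set.mem_univ, and_true,
    Set.mem_union, Set.mem_ofPred_eq]
  by_cases hp : p.1 ∈ B'
  · rw [mem_closure_band_iff hB' hf' hg' hf'g' hp]
    have hpB := hBB hp
    have h₁ := hff' _ hp
    have h₂ := hf'g' _ hp
    have h₃ := hg'g _ hp
    grind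
  · simp [hp]
end

section
/- Let n be a natural number and let F ⊆ ℝ be a finite set. Then there is no sequence α : ℕ → (Fin n → ℝ) such that for every k there exists an index i : Fin n with: α(k+1) j = α(k) j for all j < i, α(k+1) i < α(k) i, and α(k) i ∈ F. -/
/-- An antitone sequence strictly drops from a value in a finite set only finitely often. -/
theorem Antitone.finite_setOf_lt_and_mem {β : Type*} [PartialOrder β] {f : ℕ → β}
    (hf : Antitone f) {F : Set β} (hF : F.Finite) :
    {k | f (k + 1) < f k ∧ f k ∈ F}.Finite := by
  refine Set.Finite.of_finite_image (f := f) (hF.subset ?_) ?_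
  · rintro _ ⟨k, hk, rfl⟩
    exact hk.2
  · have drop : ∀ k l, f (k + 1) < f k → k < l → f l ≠ f k := fun k l hk hkl =>
      ((hf (Nat.succ_le_of_lt hkl)).trans_lt hk).ne
    intro k hk l hl hkl
    rcases lt_trichotomy k l with h | h | h
    · exact absurd hkl.symm (drop k l hk.1 h)
    · exact h
    · exact absurd hkl (drop l k hl.1 h)

/-- Abstract combinatorial core of the termination of Split: there is no
infinite sequence of points of `ℝⁿ` in which each step fixes a prefix of
coordinates and strictly decreases the next coordinate from a value lying in
a fixed finite set `F`. -/
theorem no_infinite_perturbation_sequence (n : ℕ) (F : Set ℝ)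
    (hF : F.Finite) :
    ¬ ∃ α : ℕ → (Fin n → ℝ), ∀ k, ∃ i : Fin n,
      (∀ j, j < i → α (k + 1) j = α k j) ∧
      α (k + 1) i < α k i ∧ α k i ∈ F := by
  rintro ⟨α, hα⟩
  choose i h_fix h_lt h_mem using hα
  have key : ∀ m ≤ n, ∃ N, ∀ k, N ≤ k → m ≤ (i k : ℕ) := by
    intro m
    induction m with
    | zero => exact fun _ => ⟨0, fun _ _ => Nat.zero_le _⟩
    | succ m ih =>
      intro hm
      obtain ⟨N, hN⟩ := ih (Nat.le_of_succ_le hm)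
      let c : Fin n := ⟨m, hm⟩
      have anti : Antitone fun k => α (N + k) c := by
        refine antitone_nat_of_succ_le fun k => ?_
        have hc : c ≤ i (N + k) := hN (N + k) (Nat.le_add_right N k)
        rcases hc.eq_or_lt with h | h
        · rw [h]
          exact (h_lt (N + k)).le
        · exact (h_fix (N + k) c h).le
      obtain ⟨B, hB⟩ := (anti.finite_setOf_lt_and_mem hF).bddAbove
      refine ⟨N + B + 1, fun k hk => ?_⟩
      refine Nat.succ_le_of_lt (lt_of_le_of_ne (hN k (by omega)) fun h => ?_)
      obtain ⟨d, rfl⟩ := Nat.exists_eq_add_of_le (show N ≤ k by omega)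
      have hc : i (N + d) = c := Fin.ext h.symm
      have hd : d ≤ B := hB ⟨hc ▸ h_lt (N + d), hc ▸ h_mem (N + d)⟩
      omega
  obtain ⟨N, hN⟩ := key n le_rfl
  exact absurd (i N).isLt (hN N le_rfl).not_gt
end

section
/- Let X be a topological space, B ⊆ X an open preconnected set, and f : X → ℝ a function continuous on B. Then the set {(x, y) ∈ X × ℝ : x ∈ B ∧ f x < y} is an open preconnected subset of X × ℝ. -/
/-- The half-infinite band over an open preconnected base `B`, bounded below
by a function `f` continuous on `B`, is open and preconnected in `X × ℝ`. -/
theorem half_band_isOpen_isPreconnected {X : Type*} [TopologicalSpace X]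
    {B : Set X} (hBopen : IsOpen B) (hBconn : IsPreconnected B)
    {f : X → ℝ} (hf : ContinuousOn f B) :
    IsOpen {p : X × ℝ | p.1 ∈ B ∧ f p.1 < p.2} ∧
      IsPreconnected {p : X × ℝ | p.1 ∈ B ∧ f p.1 < p.2} := by
  have hfst : ContinuousOn (fun p : X × ℝ => f p.1) (Prod.fst ⁻¹' B) :=
    hf.comp continuous_fst.continuousOn fun _ hp => hp
  constructor
  · have hdiff : ContinuousOn (fun p : X × ℝ => p.2 - f p.1) (Prod.fst ⁻¹' B) :=
      continuous_snd.continuousOn.sub hfst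
    convert hdiff.isOpen_inter_preimage (hBopen.preimage continuous_fst)
      (isOpen_Ioi (a := (0 : ℝ))) using 1
    ext p
    simp
  · have hshear : ContinuousOn (fun p : X × ℝ => (p.1, f p.1 + p.2)) (B ×ˢ Set.Ioi 0) :=
      continuous_fst.continuousOn.prodMk
        ((hfst.mono fun _ hp => hp.1).add continuous_snd.continuousOn)
    convert (hBconn.prod isPreconnected_Ioi).image _ hshear using 1
    ext ⟨x, y⟩
    constructor
    · rintro ⟨hx, hy⟩
      exact ⟨(x, y - f x), ⟨hx, sub_pos.2 hy⟩, by simp⟩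
    · rintro ⟨⟨x', t⟩, ⟨hx, ht⟩, h⟩
      obtain ⟨rfl, rfl⟩ := Prod.mk.inj h
      exact ⟨hx, lt_add_of_pos_right _ ht⟩
end
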